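/- Let h be a Brouwer homeomorphism, D a free closed topological disk, and U(D) the connected component of ℝ² \ (lim⁺D ∪ lim⁻D) containing D. Then U(D) is invariant under h, and its frontier equals lim⁺D ∪ lim⁻D. -/

import Mathlib

open Set Filter Topology

/-- The plane. -/
abbrev Plane : Type := ℝ × ℝ

/-- A homeomorphism of the plane preserves orientation iff it is isotopic to the identity. -/
def IsotopicToId (h : Plane ≃ₜ Plane) : Prop :=
  ∃ H : ℝ → Plane ≃ₜ Plane,
    Continuous (fun p : ℝ × Plane => H p.1 p.2) ∧
    H 0 = Homeomorph.refl Plane ∧ H 1 = h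

/-- A Brouwer homeomorphism: an orientation-preserving (i.e. isotopic to the identity),
fixed-point-free homeomorphism of the plane. -/
structure BrouwerHomeo where
  toHomeomorph : Plane ≃ₜ Plane
  orientationPreserving : IsotopicToId toHomeomorph
  fixedPointFree : ∀ x : Plane, toHomeomorph x ≠ x

/-- The integer iterate `h^n`. -/
def BrouwerHomeo.iter (h : BrouwerHomeo) (n : ℤ) : Plane → Plane :=
  ⇑(h.toHomeomorph.toEquiv ^ n)

/-- A set is free if it is disjoint from its image under `h`. -/
def IsFree (h : BrouwerHomeo) (E : Set Plane) : Prop :=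
  Disjoint (h.toHomeomorph '' E) E

/-- A closed topological disk: a subset of the plane homeomorphic to the closed unit disk. -/
def IsClosedDisk (D : Set Plane) : Prop :=
  Nonempty (D ≃ₜ (Metric.closedBall (0 : Plane) 1 : Set Plane))

/-- Convergence of a sequence of compact subsets of the sphere `ℝ² ∪ {∞}` to a set `L`,
in the Hausdorff sense (on the space of nonempty compact subsets of a compact metrizable
space this is exactly convergence for the Hausdorff metric): eventually the terms are
contained in any open set containing `L`, and eventually meet any open set meeting `L`. -/
def HausdorffConvergesTo (A : ℕ → Set (OnePoint Plane)) (L : Set (OnePoint Plane)) : Prop :=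
  (∀ U : Set (OnePoint Plane), IsOpen U → L ⊆ U → ∀ᶠ n in Filter.atTop, A n ⊆ U) ∧
  (∀ U : Set (OnePoint Plane), IsOpen U → (L ∩ U).Nonempty →
    ∀ᶠ n in Filter.atTop, (A n ∩ U).Nonempty)

/-- A homotopy of nonvanishing functions starting at the constant `1` has a continuous logarithm
starting at `0`. -/
theorem exists_continuous_log_homotopy {X : Type*} [TopologicalSpace X]
    (R : unitInterval × X → ℂ) (hR : Continuous R) (hR0 : ∀ p, R p ≠ 0)
    (hR1 : ∀ x, R (0, x) = 1) :
    ∃ Λ : unitInterval × X → ℂ, Continuous Λ ∧ (∀ p, Complex.exp (Λ p) = R p) ∧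
      ∀ x, Λ (0, x) = 0 := by
  let H : C(unitInterval × X, {z : ℂ // z ≠ 0}) :=
    ⟨fun p => ⟨R p, hR0 p⟩, hR.subtype_mk _⟩
  have h0 : ∀ x, H (0, x) = ⟨_, Complex.exp_ne_zero ((ContinuousMap.const X (0 : ℂ)) x)⟩ := by
    intro x; apply Subtype.ext; simp [H, hR1]
  refine ⟨Complex.isCoveringMap_exp.liftHomotopy H (ContinuousMap.const X 0) h0,
    ContinuousMap.continuous _, fun p => ?_, fun x => ?_⟩
  · have := congrFun (Complex.isCoveringMap_exp.liftHomotopy_lifts H (ContinuousMap.const X 0) h0) p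
    exact congrArg Subtype.val this
  · exact Complex.isCoveringMap_exp.liftHomotopy_zero H (ContinuousMap.const X 0) h0 x

/-- A continuous function with constant exponential on a preconnected set is constant there. -/
theorem IsPreconnected.eq_of_exp_eq {X : Type*} [TopologicalSpace X] {S : Set X}
    (hS : IsPreconnected S) {f : X → ℂ} (hf : ContinuousOn f S)
    (he : ∀ x ∈ S, ∀ y ∈ S, Complex.exp (f x) = Complex.exp (f y)) {x y : X}
    (hx : x ∈ S) (hy : y ∈ S) : f x = f y := by
  refine Complex.isCoveringMap_exp.isSeparatedMap.constOn_of_comp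
    Complex.isCoveringMap_exp.isLocalHomeomorph.isLocallyInjective hS hf
    (fun a ha b hb => Subtype.ext (he a ha b hb)) hx hy

/-- A nonvanishing continuous function on a convex set has a continuous logarithm. -/
theorem Convex.exists_continuousOn_log {E : Type*} [AddCommGroup E] [Module ℝ E]
    [TopologicalSpace E] [ContinuousAdd E] [ContinuousSMul ℝ E] {S : Set E} (hS : Convex ℝ S)
    {g : E → ℂ} (hg : ContinuousOn g S) (hg0 : ∀ x ∈ S, g x ≠ 0) :
    ∃ B : E → ℂ, ContinuousOn B S ∧ ∀ x ∈ S, Complex.exp (B x) = g x := by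
  rcases S.eq_empty_or_nonempty with rfl | ⟨a, ha⟩
  · exact ⟨0, by simp, by simp⟩
  have hmem : ∀ p : unitInterval × S,
      (1 - (p.1 : ℝ)) • a + (p.1 : ℝ) • (p.2 : E) ∈ S := fun p =>
    hS ha p.2.2 (by linarith [p.1.2.2]) p.1.2.1 (by ring)
  have hc : Continuous fun p : unitInterval × S => g ((1 - (p.1 : ℝ)) • a + (p.1 : ℝ) • (p.2 : E)) :=
    hg.comp_continuous (by fun_prop) hmem
  obtain ⟨Λ, hΛ, hexp, -⟩ := exists_continuous_log_homotopy
    (fun p : unitInterval × S => g ((1 - (p.1 : ℝ)) • a + (p.1 : ℝ) • (p.2 : E)) / g a)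
    (hc.div_const _) (fun p => div_ne_zero (hg0 _ (hmem p)) (hg0 a ha))
    (fun x => by simp [hg0 a ha])
  classical
  refine ⟨fun x => if hx : x ∈ S then Λ (1, ⟨x, hx⟩) + Complex.log (g a) else 0, ?_, ?_⟩
  · rw [continuousOn_iff_continuous_domRestrict]
    have : Continuous fun x : S => Λ (1, x) + Complex.log (g a) := by fun_prop
    convert this using 2 with x
    simp
  · intro x hx
    simp only [hx, dite_true, Complex.exp_add, hexp, Complex.exp_log (hg0 a ha)]
    simp [hg0 a ha]

/-- The chords of `f` admit a logarithm: the ratio `(f y - f x) / (y - x)` has a continuous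
symmetric logarithm on the space of pairs of distinct points. -/
def HasChordLog (f : ℂ ≃ₜ ℂ) : Prop :=
  ∃ A : ℂ × ℂ → ℂ, ContinuousOn A {p | p.1 ≠ p.2} ∧ (∀ x y, A (x, y) = A (y, x)) ∧
    ∀ x y, x ≠ y → Complex.exp (A (x, y)) = (f y - f x) / (y - x)

namespace HasChordLog

theorem refl : HasChordLog (Homeomorph.refl ℂ) := by
  refine ⟨0, continuousOn_const, fun _ _ => rfl, fun x y hxy => ?_⟩
  have : y - x ≠ 0 := sub_ne_zero.2 hxy.symm
  simp [this]

theorem trans {f g : ℂ ≃ₜ ℂ} (hf : HasChordLog f) (hg : HasChordLog g) :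
    HasChordLog (f.trans g) := by
  obtain ⟨A, hA, hAs, hAe⟩ := hf
  obtain ⟨B, hB, hBs, hBe⟩ := hg
  refine ⟨fun p => A p + B (f p.1, f p.2), ?_, fun x y => ?_, fun x y hxy => ?_⟩
  · refine hA.add (hB.comp (by fun_prop) fun p hp => ?_)
    exact fun h => hp (f.injective h)
  · simp only [hAs x y, hBs (f x) (f y)]
  · have h1 : f x ≠ f y := fun h => hxy (f.injective h)
    have h2 : f y - f x ≠ 0 := sub_ne_zero.2 h1.symm
    have h3 : y - x ≠ 0 := sub_ne_zero.2 hxy.symm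
    simp only [Complex.exp_add, hAe x y hxy, hBe _ _ h1, Homeomorph.trans_apply]
    field_simp

theorem symm {f : ℂ ≃ₜ ℂ} (hf : HasChordLog f) : HasChordLog f.symm := by
  obtain ⟨A, hA, hAs, hAe⟩ := hf
  refine ⟨fun p => -A (f.symm p.1, f.symm p.2), ?_, fun x y => ?_, fun x y hxy => ?_⟩
  · refine (hA.comp (by fun_prop) fun p hp => ?_).neg
    exact fun h => hp (f.symm.injective h)
  · simp only [hAs (f.symm x)]
  · have h1 : f.symm x ≠ f.symm y := fun h => hxy (f.symm.injective h)
    simp only [Complex.exp_neg, hAe _ _ h1, Homeomorph.apply_symm_apply, inv_div]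

/-- A perturbation of the identity with Lipschitz constant less than `1` has a chord logarithm. -/
theorem of_norm_sub_le {f : ℂ ≃ₜ ℂ} {k : ℝ} (hk : k < 1)
    (hf : ∀ x y, ‖(f y - f x) - (y - x)‖ ≤ k * ‖y - x‖) : HasChordLog f := by
  have hslit : ∀ x y, x ≠ y → (f y - f x) / (y - x) ∈ Complex.slitPlane := by
    intro x y hxy
    have h3 : y - x ≠ 0 := sub_ne_zero.2 hxy.symm
    have h4 : 0 < ‖y - x‖ := norm_pos_iff.2 h3
    refine Complex.ball_one_subset_slitPlane ?_
    rw [mem_ball_iff_norm, div_sub_one h3, norm_div, div_lt_one h4]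
    nlinarith [hf x y]
  refine ⟨fun p => Complex.log ((f p.2 - f p.1) / (p.2 - p.1)), ?_, fun x y => ?_,
    fun x y hxy => Complex.exp_log (Complex.slitPlane_ne_zero (hslit x y hxy))⟩
  · refine ContinuousOn.clog (ContinuousOn.div (by fun_prop) (by fun_prop) fun p hp => ?_)
      fun p hp => hslit _ _ hp
    exact sub_ne_zero.2 (Ne.symm hp)
  · simp only
    rw [← neg_sub (f x), ← neg_sub x, neg_div_neg_eq]

/-- A homeomorphism isotopic to the identity has a chord logarithm. -/
theorem of_isotopy (H : ℝ → ℂ ≃ₜ ℂ) (hH : Continuous fun p : ℝ × ℂ => H p.1 p.2)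
    (h0 : H 0 = Homeomorph.refl ℂ) : HasChordLog (H 1) := by
  have hne : ∀ p : unitInterval × {p : ℂ × ℂ // p.1 ≠ p.2}, p.2.1.2 - p.2.1.1 ≠ 0 := fun p =>
    sub_ne_zero.2 (Ne.symm p.2.2)
  have hc : ∀ g : unitInterval × {p : ℂ × ℂ // p.1 ≠ p.2} → ℂ, Continuous g →
      Continuous fun p : unitInterval × {p : ℂ × ℂ // p.1 ≠ p.2} => H p.1 (g p) := fun g hg =>
    hH.comp ((continuous_subtype_val.comp continuous_fst).prodMk hg)
  obtain ⟨Λ, hΛ, hexp, hΛ0⟩ := exists_continuous_log_homotopy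
    (fun p : unitInterval × {p : ℂ × ℂ // p.1 ≠ p.2} =>
      (H p.1 p.2.1.2 - H p.1 p.2.1.1) / (p.2.1.2 - p.2.1.1))
    (((hc _ (by fun_prop)).sub (hc _ (by fun_prop))).div (by fun_prop) hne)
    (fun p => div_ne_zero (sub_ne_zero.2 fun h => p.2.2 ((H p.1).injective h.symm)) (hne p))
    (fun x => by simpa [h0] using div_self (hne (0, x)))
  have hsymm : ∀ x y (h : x ≠ y), Λ (1, ⟨(x, y), h⟩) = Λ (1, ⟨(y, x), h.symm⟩) := by
    intro x y h
    have key := isPreconnected_univ.eq_of_exp_eq (X := unitInterval)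
      (f := fun t => Λ (t, ⟨(x, y), h⟩) - Λ (t, ⟨(y, x), h.symm⟩)) (by fun_prop)
      (fun s _ t _ => by
        have : ∀ t : unitInterval, Complex.exp
            (Λ (t, ⟨(x, y), h⟩) - Λ (t, ⟨(y, x), h.symm⟩)) = 1 := fun t => by
          rw [Complex.exp_sub, div_eq_one_iff_eq (Complex.exp_ne_zero _), hexp, hexp]
          simp only
          rw [← neg_sub (H _ x), ← neg_sub x, neg_div_neg_eq]
        rw [this, this]) (mem_univ 1) (mem_univ 0)
    simp only [hΛ0, sub_self] at key
    exact sub_eq_zero.1 key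
  classical
  refine ⟨fun p => if hp : p.1 ≠ p.2 then Λ (1, ⟨p, hp⟩) else 0, ?_, fun x y => ?_,
    fun x y hxy => ?_⟩
  · rw [continuousOn_iff_continuous_domRestrict]
    have : Continuous fun x : {p : ℂ × ℂ // p.1 ≠ p.2} => Λ (1, x) := by fun_prop
    refine this.congr fun x => ?_
    change _ = dite _ _ _
    rw [dif_pos x.2]
  · by_cases h : x = y
    · simp [h]
    · simp only [ne_eq, h, Ne.symm h, not_false_eq_true, dite_true]
      exact hsymm x y h
  · simp only [ne_eq, hxy, not_false_eq_true, dite_true, hexp]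
    simp

/-- The chord logarithm `A` of a fixed-point-free `f` can be normalized so that `A (x, f x)` is the
increment of a logarithm of the displacement of `f` from `x` to `f x`. -/
theorem exists_displacement_log {f : ℂ ≃ₜ ℂ} (hf : HasChordLog f) (hfix : ∀ x, f x ≠ x) :
    ∃ (A : ℂ × ℂ → ℂ) (Θ : ℂ → ℂ), ContinuousOn A {p | p.1 ≠ p.2} ∧
      (∀ x y, A (x, y) = A (y, x)) ∧
      (∀ x y, x ≠ y → Complex.exp (A (x, y)) = (f y - f x) / (y - x)) ∧
      Continuous Θ ∧ (∀ x, Complex.exp (Θ x) = f x - x) ∧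
      ∀ x, Θ (f x) - Θ x = A (x, f x) := by
  obtain ⟨A, hA, hAs, hAe⟩ := hf
  obtain ⟨Θ, hΘ, hΘe⟩ := (convex_univ (𝕜 := ℝ) (E := ℂ)).exists_continuousOn_log
    (g := fun x => f x - x) (by fun_prop) fun x _ => sub_ne_zero.2 (hfix x)
  rw [continuousOn_univ] at hΘ
  have h1 : ∀ x, Complex.exp (Θ (f x) - Θ x - A (x, f x)) = 1 := fun x => by
    have h3 : f x - x ≠ 0 := sub_ne_zero.2 (hfix x)
    have h4 : f (f x) - f x ≠ 0 := sub_ne_zero.2 (hfix (f x))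
    rw [Complex.exp_sub, Complex.exp_sub, hΘe _ (mem_univ _), hΘe _ (mem_univ _),
      hAe _ _ (hfix x).symm, div_self (div_ne_zero h4 h3)]
  have hc : Continuous fun x => Θ (f x) - Θ x - A (x, f x) :=
    ((hΘ.comp f.continuous).sub hΘ).sub
      (hA.comp_continuous (by fun_prop) fun x => (hfix x).symm)
  set K := Θ (f 0) - Θ 0 - A (0, f 0) with hK
  have hKx : ∀ x, Θ (f x) - Θ x - A (x, f x) = K := fun x =>
    isPreconnected_univ.eq_of_exp_eq hc.continuousOn (fun _ _ _ _ => by rw [h1, h1])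
      (mem_univ x) (mem_univ 0)
  have hexpK : Complex.exp K = 1 := h1 0
  refine ⟨fun p => A p + K, Θ, hA.add continuousOn_const, fun x y => by simp only [hAs x y],
    fun x y hxy => by simp only [Complex.exp_add, hexpK, hAe x y hxy, mul_one], hΘ,
    fun x => hΘe x (mem_univ x), fun x => ?_⟩
  linear_combination hKx x

/-- A fixed-point-free homeomorphism with a chord logarithm has no point of period two. -/
theorem apply_apply_ne {f : ℂ ≃ₜ ℂ} (hf : HasChordLog f) (hfix : ∀ x, f x ≠ x) (p : ℂ) :
    f (f p) ≠ p := by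
  intro hp
  obtain ⟨A, Θ, -, hAs, -, -, hΘe, hk⟩ := hf.exists_displacement_log hfix
  have h1 := hk p
  have h2 := hk (f p)
  rw [hp, hAs] at h2
  have h3 : Θ (f p) = Θ p := by linear_combination (h1 - h2) / 2
  have h4 := hΘe (f p)
  rw [h3, hΘe, hp] at h4
  exact hfix p (by linear_combination h4 / 2)

/-- A fixed-point-free `f` admits no closed curve `c` on `[0, n]` with `f (c s) = c (s + 1)`
whose chords of parameter length at least `1` are nondegenerate. -/
theorem false_of_closed_orbit_curve {f : ℂ ≃ₜ ℂ} (hf : HasChordLog f) (hfix : ∀ x, f x ≠ x)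
    {n : ℝ} (hn : 2 ≤ n) {c : ℝ → ℂ} (hc : ContinuousOn c (Icc 0 n))
    (hshift : ∀ s ∈ Icc 0 (n - 1), c (s + 1) = f (c s)) (hclosed : c n = c 0)
    (hne : ∀ s u, 0 ≤ s → s + 1 ≤ u → u ≤ n → (0 < s ∨ u < n) → c s ≠ c u) : False := by
  obtain ⟨A, Θ, hA, hAs, hAe, hΘ, hΘe, hk⟩ := hf.exists_displacement_log hfix
  set T : Set (ℝ × ℝ) := {p | 0 ≤ p.1 ∧ p.1 + 1 ≤ p.2 ∧ p.2 ≤ n ∧ 0 < p.1 + (n - p.2)} with hT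
  have hTc : Convex ℝ T := by
    rintro ⟨s, u⟩ ⟨h1, h2, h3, h4⟩ ⟨s', u'⟩ ⟨h1', h2', h3', h4'⟩ a b ha hb hab
    simp only at *
    have hb' : b = 1 - a := by linarith
    subst hb'
    refine ⟨?_, ?_, ?_, ?_⟩ <;> simp only [Prod.smul_mk, Prod.mk_add_mk, smul_eq_mul]
    · positivity
    · nlinarith
    · nlinarith
    · rcases ha.eq_or_lt with rfl | ha
      · linarith
      · nlinarith [mul_pos ha h4, mul_nonneg hb h4'.le]
  have hTne : ∀ p ∈ T, c p.1 ≠ c p.2 := by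
    rintro ⟨s, u⟩ ⟨h1, h2, h3, h4⟩
    refine hne s u h1 h2 h3 ?_
    simp only at *
    by_contra! h
    linarith [h.1, h.2]
  have hcT : ContinuousOn (fun p : ℝ × ℝ => c p.2 - c p.1) T := by
    refine (hc.comp (by fun_prop) ?_).sub (hc.comp (by fun_prop) ?_) <;>
    · rintro ⟨s, u⟩ ⟨h1, h2, h3, h4⟩
      constructor <;> simp only at * <;> linarith
  obtain ⟨B, hB, hBe⟩ := hTc.exists_continuousOn_log hcT
    fun p hp => sub_ne_zero.2 (hTne p hp).symm
  have hdiag : ∀ s ∈ Icc 0 (n - 1), ((s, s + 1) : ℝ × ℝ) ∈ T := fun s hs =>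
    ⟨hs.1, le_rfl, by linarith [hs.2], by simp only; linarith⟩
  have hBΘ : ∀ s ∈ Icc 0 (n - 1), ∀ s' ∈ Icc 0 (n - 1),
      B (s, s + 1) - Θ (c s) = B (s', s' + 1) - Θ (c s') := by
    intro s hs s' hs'
    refine isPreconnected_Icc.eq_of_exp_eq (f := fun s => B (s, s + 1) - Θ (c s)) ?_
      ?_ hs hs'
    · refine (hB.comp (by fun_prop) hdiag).sub (hΘ.comp_continuousOn (hc.mono ?_))
      exact Icc_subset_Icc_right (by linarith)
    · have : ∀ s ∈ Icc 0 (n - 1), Complex.exp (B (s, s + 1) - Θ (c s)) = 1 := fun s hs => by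
        rw [Complex.exp_sub, hBe _ (hdiag s hs), hΘe, hshift s hs,
          div_self (sub_ne_zero.2 (hfix _))]
      intro x hx y hy
      rw [this x hx, this y hy]
  have hTs : ∀ u ∈ Icc 1 (n - 1), ((0, u) : ℝ × ℝ) ∈ T ∧ ((1, u + 1) : ℝ × ℝ) ∈ T ∧
      ((u, n) : ℝ × ℝ) ∈ T := fun u hu =>
    ⟨⟨le_rfl, by simpa using hu.1, by simp only; linarith [hu.2], by simp only; linarith [hu.2]⟩,
      ⟨zero_le_one, by simp only; linarith [hu.1], by simp only; linarith [hu.2],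
        by simp only; linarith [hu.2]⟩,
      ⟨by simp only; linarith [hu.1], by simp only; linarith [hu.2], le_rfl,
        by simp only; linarith [hu.1]⟩⟩
  have m1 : (1 : ℝ) ∈ Icc 1 (n - 1) := ⟨le_rfl, by linarith⟩
  have m2 : n - 1 ∈ Icc 1 (n - 1) := ⟨by linarith, le_rfl⟩
  have d0 : (0 : ℝ) ∈ Icc 0 (n - 1) := ⟨le_rfl, by linarith⟩
  have d1 : (1 : ℝ) ∈ Icc 0 (n - 1) := ⟨zero_le_one, by linarith⟩
  have d2 : n - 1 ∈ Icc 0 (n - 1) := ⟨by linarith, le_rfl⟩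
  have hsub : Icc 1 (n - 1) ⊆ Icc 0 (n - 1) := Icc_subset_Icc_left zero_le_one
  -- the chord from `c 0` to `c u` is mapped to the chord from `c 1` to `c (u + 1)`
  have hAB : A (c 0, c 1) - (B (1, 1 + 1) - B (0, 1)) =
      A (c 0, c (n - 1)) - (B (1, (n - 1) + 1) - B (0, n - 1)) := by
    refine isPreconnected_Icc.eq_of_exp_eq
      (f := fun u => A (c 0, c u) - (B (1, u + 1) - B (0, u))) ?_ ?_ m1 m2
    · refine (hA.comp (continuousOn_const.prodMk (hc.mono ?_)) ?_).sub
        ((hB.comp (by fun_prop) fun u hu => (hTs u hu).2.1).sub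
          (hB.comp (by fun_prop) fun u hu => (hTs u hu).1))
      · exact Icc_subset_Icc zero_le_one (by linarith)
      · exact fun u hu => hTne _ (hTs u hu).1
    · have : ∀ u ∈ Icc 1 (n - 1),
          Complex.exp (A (c 0, c u) - (B (1, u + 1) - B (0, u))) = 1 := fun u hu => by
        have h01 := hshift 0 d0
        rw [zero_add] at h01
        have h2 : c 0 ≠ c u := hTne _ (hTs u hu).1
        have h3 : c u - c 0 ≠ 0 := sub_ne_zero.2 h2.symm
        have h4 : f (c u) - f (c 0) ≠ 0 := sub_ne_zero.2 fun h => h2 (f.injective h).symm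
        rw [Complex.exp_sub, Complex.exp_sub, hBe _ (hTs u hu).1, hBe _ (hTs u hu).2.1,
          hAe _ _ h2]
        simp only [hshift u (hsub hu), h01]
        exact div_self (div_ne_zero h4 h3)
      intro x hx y hy
      rw [this x hx, this y hy]
  -- the chords from `c 0` and to `c n = c 0` are opposite
  have hopp : ∀ u ∈ Icc 1 (n - 1), Complex.exp (B (u, n) - B (0, u)) = -1 := fun u hu => by
    have h3 : c u - c 0 ≠ 0 := sub_ne_zero.2 (hTne _ (hTs u hu).1).symm
    rw [Complex.exp_sub, hBe _ (hTs u hu).1, hBe _ (hTs u hu).2.2]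
    simp only [hclosed]
    rw [← neg_sub (c u), neg_div, div_self h3]
  have hD : B (1, n) - B (0, 1) = B (n - 1, n) - B (0, n - 1) := by
    refine isPreconnected_Icc.eq_of_exp_eq (f := fun u => B (u, n) - B (0, u)) ?_ ?_ m1 m2
    · exact (hB.comp (by fun_prop) fun u hu => (hTs u hu).2.2).sub
        (hB.comp (by fun_prop) fun u hu => (hTs u hu).1)
    · intro x hx y hy
      rw [hopp x hx, hopp y hy]
  have e1 := hBΘ 0 d0 1 d1
  have e2 := hBΘ 0 d0 (n - 1) d2
  have k1 := hk (c 0)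
  have k2 := hk (c (n - 1))
  have h01 := hshift 0 d0
  have hn1 := hshift (n - 1) d2
  simp only [zero_add, sub_add_cancel] at h01 hn1 e1 e2 hAB
  rw [← h01] at k1
  rw [← hn1, hclosed, hAs] at k2
  have hzero : B (1, n) - B (0, 1) = 0 := by
    linear_combination (hAB + hD + k1 - e1 - k2 - e2) / 2
  have := hopp 1 m1
  rw [hzero, Complex.exp_zero] at this
  norm_num at this

end HasChordLog

/-- A point `a` can be pushed to any point of `ball a ε` by a homeomorphism supported there. -/
theorem exists_homeomorph_push {a b : ℂ} {ε : ℝ} (hb : b ∈ Metric.ball a ε) :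
    ∃ φ : ℂ ≃ₜ ℂ, HasChordLog φ ∧ (∀ z ∉ Metric.ball a ε, φ z = z) ∧ φ a = b := by
  rw [mem_ball_iff_norm] at hb
  have hε : 0 < ε := (norm_nonneg _).trans_lt hb
  set g : ℂ → ℂ := fun x => x + (max 0 (1 - ‖x - a‖ / ε) : ℝ) • (b - a) with hg
  have hlip : ∀ x y, ‖g y - g x - (y - x)‖ ≤ ‖b - a‖ / ε * ‖y - x‖ := by
    intro x y
    have h1 : g y - g x - (y - x) =
        (max 0 (1 - ‖y - a‖ / ε) - max 0 (1 - ‖x - a‖ / ε) : ℝ) • (b - a) := by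
      simp only [hg, sub_smul]; ring
    have h2 : |max 0 (1 - ‖y - a‖ / ε) - max 0 (1 - ‖x - a‖ / ε)| ≤ ‖y - x‖ / ε := by
      rw [max_comm 0, max_comm 0]
      refine (abs_max_sub_max_le_abs _ _ _).trans ?_
      have h3 : 1 - ‖y - a‖ / ε - (1 - ‖x - a‖ / ε) = (‖x - a‖ - ‖y - a‖) / ε := by ring
      rw [h3, abs_div, abs_of_pos hε]
      gcongr
      calc |‖x - a‖ - ‖y - a‖| ≤ ‖x - a - (y - a)‖ := abs_norm_sub_norm_le _ _
        _ = ‖y - x‖ := by rw [sub_sub_sub_cancel_right, norm_sub_rev]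
    rw [h1, norm_smul, Real.norm_eq_abs]
    calc _ ≤ ‖y - x‖ / ε * ‖b - a‖ := by gcongr
      _ = ‖b - a‖ / ε * ‖y - x‖ := by ring
  have hk : ‖b - a‖ / ε < 1 := (div_lt_one hε).2 hb
  have happ : ApproximatesLinearOn g ((ContinuousLinearEquiv.refl ℝ ℂ : ℂ ≃L[ℝ] ℂ) : ℂ →L[ℝ] ℂ)
      univ ⟨‖b - a‖ / ε, by positivity⟩ := fun x _ y _ => hlip y x
  have hN : ‖((ContinuousLinearEquiv.refl ℝ ℂ).symm : ℂ →L[ℝ] ℂ)‖₊ = 1 := by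
    ext
    exact ContinuousLinearMap.norm_id
  refine ⟨happ.toHomeomorph g (Or.inr ?_), HasChordLog.of_norm_sub_le hk hlip,
    fun z hz => ?_, ?_⟩
  · rw [hN, inv_one]
    exact hk
  · change g z = z
    rw [mem_ball_iff_norm, not_lt] at hz
    have : max 0 (1 - ‖z - a‖ / ε) = 0 := max_eq_left (by
      rw [sub_nonpos]; exact (one_le_div hε).2 hz)
    simp [hg, this]
  · change g a = b
    simp [hg]

/-- Points of a connected open set can be moved to each other by a homeomorphism supported there. -/
theorem exists_homeomorph_move {V : Set ℂ} (hV : IsOpen V) (hVc : IsPreconnected V) {x y : ℂ}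
    (hx : x ∈ V) (hy : y ∈ V) :
    ∃ φ : ℂ ≃ₜ ℂ, HasChordLog φ ∧ (∀ z ∉ V, φ z = z) ∧ φ x = y := by
  set u : Set ℂ := {y | y ∈ V ∧ ∃ φ : ℂ ≃ₜ ℂ, HasChordLog φ ∧ (∀ z ∉ V, φ z = z) ∧ φ x = y}
    with hu
  have hopen : IsOpen u := by
    refine Metric.isOpen_iff.2 fun y hy => ?_
    obtain ⟨hyV, φ, hφ, hφV, hφx⟩ := hy
    obtain ⟨ε, hε, hball⟩ := Metric.isOpen_iff.1 hV y hyV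
    refine ⟨ε, hε, fun b hb => ⟨hball hb, ?_⟩⟩
    obtain ⟨ψ, hψ, hψb, hψy⟩ := exists_homeomorph_push hb
    refine ⟨φ.trans ψ, hφ.trans hψ, fun z hz => ?_, by simp [hφx, hψy]⟩
    rw [Homeomorph.trans_apply, hφV z hz, hψb z fun h => hz (hball h)]
  refine (hVc.subset_of_closure_inter_subset hopen
    ⟨x, hx, hx, Homeomorph.refl ℂ, HasChordLog.refl, fun _ _ => rfl, rfl⟩ ?_ hy).2
  rintro y ⟨hyu, hyV⟩
  obtain ⟨ε, hε, hball⟩ := Metric.isOpen_iff.1 hV y hyV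
  obtain ⟨b, ⟨-, φ, hφ, hφV, hφx⟩, hb⟩ := Metric.mem_closure_iff.1 hyu ε hε
  obtain ⟨ψ, hψ, hψb, hψy⟩ := exists_homeomorph_push (Metric.mem_ball'.2 hb)
  refine ⟨hyV, φ.trans ψ.symm, hφ.trans hψ.symm, fun z hz => ?_, ?_⟩
  · rw [Homeomorph.trans_apply, hφV z hz, Homeomorph.symm_apply_eq,
      hψb z fun h => hz (hball h)]
  · rw [Homeomorph.trans_apply, hφx, Homeomorph.symm_apply_eq, hψy]

/-- No fixed-point-free homeomorphism whose chords admit a logarithm has a point of period `m`. -/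
def NoPeriodicPoint (m : ℕ) : Prop :=
  ∀ g : ℂ ≃ₜ ℂ, HasChordLog g → (∀ x, g x ≠ x) → ∀ p, g^[m] p ≠ p

/-- If there are no points of period at most `m`, then a free connected open set is disjoint from
its `m`-th iterate: otherwise a homeomorphism supported in this set would close an orbit. -/
theorem iterate_notMem_of_noPeriodicPoint {f : ℂ ≃ₜ ℂ} (hf : HasChordLog f) (hfix : ∀ x, f x ≠ x)
    {V : Set ℂ} (hV : IsOpen V) (hVc : IsPreconnected V) (hfree : ∀ x ∈ V, f x ∉ V) (m : ℕ)
    (hm : 1 ≤ m) (hper : ∀ k, 1 ≤ k → k ≤ m → NoPeriodicPoint k) :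
    ∀ x ∈ V, f^[m] x ∉ V := by
  induction m using Nat.strong_induction_on with
  | _ m ih =>
  intro x hx hy
  obtain ⟨φ, hφ, hφV, hφy⟩ := exists_homeomorph_move hV hVc hy hx
  have hiter : ∀ i, i + 1 ≤ m → (φ.trans f)^[i + 1] (f^[m] x) = f^[i + 1] x := by
    intro i
    induction i with
    | zero => intro _; simp [hφy]
    | succ i ihi =>
      intro hi
      rw [Function.iterate_succ_apply', ihi (by omega), Homeomorph.trans_apply,
        hφV _ (ih (i + 1) (by omega) (by omega) (fun k h1 h2 => hper k h1 (by omega)) x hx),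
        ← Function.iterate_succ_apply' (⇑f)]
  obtain ⟨k, rfl⟩ : ∃ k, m = k + 1 := ⟨m - 1, by omega⟩
  refine hper (k + 1) hm le_rfl (φ.trans f) (hφ.trans hf) (fun z hz => ?_) _ (hiter k le_rfl)
  rw [Homeomorph.trans_apply] at hz
  by_cases hzV : z ∈ V
  · have hφz : φ z ∈ V := by
      by_contra h
      have := φ.injective (hφV _ h)
      exact h (by rwa [this])
    exact hfree _ hφz (by rwa [hz])
  · rw [hφV z hzV] at hz
    exact hfix z hz

/-- A free continuum has a free connected open neighbourhood. -/
theorem exists_open_free {X : Type*} [TopologicalSpace X] [T2Space X] [LocallyConnectedSpace X]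
    (f : X ≃ₜ X) {K : Set X} (hK : IsCompact K) (hKc : IsPreconnected K)
    (hfree : Disjoint (f '' K) K) :
    ∃ V, IsOpen V ∧ IsPreconnected V ∧ K ⊆ V ∧ ∀ x ∈ V, f x ∉ V := by
  rcases K.eq_empty_or_nonempty with rfl | ⟨a, ha⟩
  · exact ⟨∅, isOpen_empty, isPreconnected_empty, subset_rfl, by simp⟩
  obtain ⟨U₁, U₂, h₁, h₂, hs₁, hs₂, hd⟩ :=
    SeparatedNhds.of_isCompact_isCompact (hK.image f.continuous) hK hfree
  have hW : IsOpen (U₂ ∩ f ⁻¹' U₁) := h₂.inter (h₁.preimage f.continuous)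
  have hKW : K ⊆ U₂ ∩ f ⁻¹' U₁ := fun x hx => ⟨hs₂ hx, hs₁ (mem_image_of_mem f hx)⟩
  refine ⟨connectedComponentIn (U₂ ∩ f ⁻¹' U₁) a, hW.connectedComponentIn,
    isPreconnected_connectedComponentIn, hKc.subset_connectedComponentIn ha hKW,
    fun x hx hfx => ?_⟩
  exact disjoint_left.1 hd (connectedComponentIn_subset _ _ hx).2
    (connectedComponentIn_subset _ _ hfx).1

/-- If a homeomorphism displaces an open ball off itself, then it can map a point of the closed
ball into the closed ball only along the boundary. -/
theorem dist_eq_of_ball_displaced {g : ℂ ≃ₜ ℂ} {p : ℂ} {r : ℝ} (hr : 0 < r)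
    (hg : ∀ x ∈ Metric.ball p r, g x ∉ Metric.ball p r) {u : ℂ} (hu : dist u p ≤ r)
    (hgu : dist (g u) p ≤ r) : dist u p = r ∧ dist (g u) p = r := by
  have hcl := closure_ball p hr.ne'
  constructor
  · refine hu.eq_of_not_lt fun hlt => ?_
    have hmem : g u ∈ closure (Metric.ball p r) := by rw [hcl]; exact hgu
    obtain ⟨w, hw, hwb⟩ := mem_closure_iff.1 hmem (g '' Metric.ball p r)
      (g.isOpenMap _ Metric.isOpen_ball) ⟨u, hlt, rfl⟩
    obtain ⟨v, hv, rfl⟩ := hw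
    exact hg v hv hwb
  · refine hgu.eq_of_not_lt fun hlt => ?_
    have hmem : u ∈ closure (Metric.ball p r) := by rw [hcl]; exact hu
    obtain ⟨w, hw, hwb⟩ := mem_closure_iff.1 hmem (g ⁻¹' Metric.ball p r)
      (Metric.isOpen_ball.preimage g.continuous) hlt
    exact hg w hwb hw

/-- The largest free ball centred at `p` touches its image. -/
theorem exists_maximal_free_ball (f : ℂ ≃ₜ ℂ) (hfix : ∀ x, f x ≠ x) (p : ℂ) :
    ∃ r > 0, (∀ x ∈ Metric.ball p r, f x ∉ Metric.ball p r) ∧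
      ∃ z, dist z p = r ∧ dist (f z) p = r := by
  have hlim : Tendsto (fun x => max (dist x p) (dist (f x) p)) (cocompact ℂ) atTop :=
    tendsto_atTop_mono (fun x => le_max_left _ _) (tendsto_dist_right_cocompact_atTop p)
  obtain ⟨z, hz⟩ := Continuous.exists_forall_le (by fun_prop) hlim
  have hr : 0 < max (dist z p) (dist (f z) p) := by
    by_contra! h
    have h1 := dist_le_zero.1 ((le_max_left _ _).trans h)
    have h2 := dist_le_zero.1 ((le_max_right _ _).trans h)
    exact hfix z (h2.trans h1.symm)
  have hfree : ∀ x ∈ Metric.ball p (max (dist z p) (dist (f z) p)),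
      f x ∉ Metric.ball p (max (dist z p) (dist (f z) p)) := fun x hx hfx =>
    (hz x).not_gt (max_lt hx hfx)
  exact ⟨_, hr, hfree, z,
    dist_eq_of_ball_displaced hr hfree (le_max_left _ _) (le_max_right _ _)⟩

/-- An arc from `p` to `f p` whose half-open part is free. -/
theorem exists_translation_arc {f : ℂ ≃ₜ ℂ} (hfix : ∀ x, f x ≠ x)
    (hfree2 : ∀ V : Set ℂ, IsOpen V → IsPreconnected V → (∀ x ∈ V, f x ∉ V) →
      ∀ x ∈ V, f (f x) ∉ V) (p : ℂ) :
    ∃ α : ℝ → ℂ, Continuous α ∧ α 0 = p ∧ α 1 = f p ∧ (∀ s ∈ Ioo 0 1, α s ≠ p) ∧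
      ∀ s ∈ Ico 0 1, ∀ t ∈ Ico 0 1, f (α t) ≠ α s := by
  obtain ⟨r, hr, hball, z, hz, hfz⟩ := exists_maximal_free_ball f hfix p
  have hball2 : ∀ x ∈ Metric.ball p r, (f.trans f) x ∉ Metric.ball p r :=
    hfree2 _ Metric.isOpen_ball (convex_ball p r).isPreconnected hball
  set w := f z with hw
  set a : ℝ → ℂ := fun s => p + (2 * s) • (w - p) with ha
  set b : ℝ → ℂ := fun s => p + (2 - 2 * s) • (z - p) with hb
  have hda : ∀ s, 0 ≤ s → dist (a s) p = 2 * s * r := fun s hs => by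
    rw [dist_eq_norm, add_sub_cancel_left, norm_smul, ← dist_eq_norm w, hfz,
      Real.norm_of_nonneg (by linarith)]
  have hdb : ∀ s, s ≤ 1 → dist (b s) p = (2 - 2 * s) * r := fun s hs => by
    rw [dist_eq_norm, add_sub_cancel_left, norm_smul, ← dist_eq_norm z, hz,
      Real.norm_of_nonneg (by linarith)]
  refine ⟨fun s => if s ≤ 1 / 2 then a s else f (b s), ?_, by simp [ha], ?_, ?_, ?_⟩
  · refine Continuous.if_le (by fun_prop) (by fun_prop) continuous_id continuous_const ?_
    rintro s rfl
    simp only [ha, hb, hw]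
    norm_num
  · norm_num [hb]
  · rintro s ⟨hs0, hs1⟩
    simp only
    split_ifs with h
    · intro he
      have h1 := hda s hs0.le
      rw [he, dist_self] at h1
      have : 0 < 2 * s * r := by positivity
      linarith
    · intro he
      have h1 := hdb s hs1.le
      have h2 := (dist_eq_of_ball_displaced hr hball (u := b s) (by rw [h1]; nlinarith)
        (by rw [he, dist_self]; exact hr.le)).2
      rw [he, dist_self] at h2
      exact hr.ne h2
  · rintro s ⟨hs0, hs1⟩ t ⟨ht0, ht1⟩ he
    simp only at he
    have hdas := hda s hs0
    have hdat := hda t ht0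
    have hdbs := hdb s hs1.le
    have hdbt := hdb t ht1.le
    split_ifs at he with h1 h2 h2
    · have h3 := dist_eq_of_ball_displaced hr hball (u := a t) (by rw [hdat]; nlinarith)
        (by rw [he, hdas]; nlinarith)
      rw [he, hdat, hdas] at h3
      have hs : s = 1 / 2 := by nlinarith [h3.2]
      have ht : t = 1 / 2 := by nlinarith [h3.1]
      rw [hs, ht] at he
      exact hfix _ he
    · have he' := f.injective he
      have h3 : 2 * t = 2 - 2 * s := by
        have := hdat.symm.trans ((congrArg (dist · p) he').trans hdbs)
        nlinarith
      simp only [ha, hb, h3, add_right_inj] at he'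
      have h4 := smul_right_injective ℂ (show (2 - 2 * s : ℝ) ≠ 0 by linarith) he'
      exact hfix z (sub_left_injective h4)
    · have h3 := dist_eq_of_ball_displaced (g := f.trans f) hr hball2 (u := b t)
        (by rw [hdbt]; nlinarith) (by rw [Homeomorph.trans_apply, he, hdas]; nlinarith)
      rw [hdbt] at h3
      nlinarith [h3.1]
    · have he' := f.injective he
      have h3 := dist_eq_of_ball_displaced hr hball (u := b t) (by rw [hdbt]; nlinarith)
        (by rw [he', hdbs]; nlinarith)
      rw [hdbt] at h3
      nlinarith [h3.1]

/-- A fixed-point-free homeomorphism with a chord logarithm has no periodic point. -/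
theorem noPeriodicPoint (n : ℕ) (hn : 1 ≤ n) : NoPeriodicPoint n := by
  induction n using Nat.strong_induction_on with
  | _ n ih =>
  intro f hf hfix p hp
  obtain rfl | rfl | hn3 : n = 1 ∨ n = 2 ∨ 3 ≤ n := by omega
  · exact hfix p hp
  · exact hf.apply_apply_ne hfix p hp
  have hV : ∀ m, 1 ≤ m → m < n → ∀ V : Set ℂ, IsOpen V → IsPreconnected V →
      (∀ x ∈ V, f x ∉ V) → ∀ x ∈ V, f^[m] x ∉ V := fun m hm hmn V hVo hVc hVf =>
    iterate_notMem_of_noPeriodicPoint hf hfix hVo hVc hVf m hm fun k hk hkm => ih k (by omega) hk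
  obtain ⟨α, hα, hα0, hα1, hαp, hαf⟩ :=
    exists_translation_arc hfix (hV 2 (by omega) (by omega)) p
  have harc : ∀ m, 1 ≤ m → m < n → ∀ s ∈ Ico (0 : ℝ) 1, ∀ t ∈ Ico (0 : ℝ) 1,
      f^[m] (α t) ≠ α s := by
    intro m hm hmn s hs t ht he
    have hlt : max s t < 1 := max_lt hs.2 ht.2
    obtain ⟨V, hVo, hVc, hKV, hVf⟩ := exists_open_free f
      (isCompact_Icc.image hα : IsCompact (α '' Icc 0 (max s t)))
      (isPreconnected_Icc.image _ hα.continuousOn) (by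
        rw [disjoint_left]
        rintro _ ⟨_, ⟨u, hu, rfl⟩, rfl⟩ ⟨v, hv, hvu⟩
        exact hαf v ⟨hv.1, hv.2.trans_lt hlt⟩ u ⟨hu.1, hu.2.trans_lt hlt⟩ hvu.symm)
    refine hV m hm hmn V hVo hVc hVf (α t) (hKV ⟨t, ⟨ht.1, le_max_right _ _⟩, rfl⟩) ?_
    rw [he]
    exact hKV ⟨s, ⟨hs.1, le_max_left _ _⟩, rfl⟩
  set c : ℝ → ℂ := fun s => f^[⌊s⌋₊] (α (s - ⌊s⌋₊)) with hc
  have hshift : ∀ s, 0 ≤ s → c (s + 1) = f (c s) := fun s hs => by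
    simp only [hc, Nat.floor_add_one hs, Function.iterate_succ_apply']
    congr 3
    push_cast
    ring
  have hnat : ∀ k : ℕ, c k = f^[k] p := fun k => by simp [hc, hα0]
  have hc01 : EqOn c α (Icc 0 1) := by
    rintro s ⟨hs0, hs1⟩
    rcases hs1.eq_or_lt with rfl | hs1
    · rw [← Nat.cast_one, hnat, Nat.cast_one, hα1]
      rfl
    · have : ⌊s⌋₊ = 0 := Nat.floor_eq_zero.2 hs1
      simp [hc, this]
  have hcont : ∀ k : ℕ, ContinuousOn c (Icc 0 (k + 1)) := by
    intro k
    induction k with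
    | zero => simpa using hα.continuousOn.congr hc01
    | succ k ihk =>
      have hunion : Icc (0 : ℝ) ((k + 1 : ℕ) + 1) =
          Icc (0 : ℝ) 1 ∪ Icc (1 : ℝ) ((k + 1 : ℕ) + 1) := by
        rw [Icc_union_Icc_eq_Icc zero_le_one]
        push_cast
        linarith [(Nat.cast_nonneg k : (0 : ℝ) ≤ k)]
      rw [hunion]
      refine (hα.continuousOn.congr hc01).union_of_isClosed ?_ isClosed_Icc isClosed_Icc
      have h1 : ContinuousOn (fun s => f (c (s - 1))) (Icc 1 ((k + 1 : ℕ) + 1)) := by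
        refine f.continuous.comp_continuousOn (ihk.comp (by fun_prop) ?_)
        rintro s ⟨hs1, hs2⟩
        push_cast at hs2
        exact ⟨by linarith, by linarith⟩
      refine h1.congr fun s hs => ?_
      change c s = f (c (s - 1))
      rw [← hshift _ (sub_nonneg.2 hs.1), sub_add_cancel]
  refine hf.false_of_closed_orbit_curve hfix (n := n) (c := c) (by exact_mod_cast (by omega : 2 ≤ n))
    ?_ (fun s hs => hshift s hs.1) ?_ ?_
  · convert hcont (n - 1) using 2
    rw [Nat.cast_sub hn]
    simp
  · rw [hnat, hp, ← Nat.cast_zero, hnat]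
    rfl
  · intro s u hs hsu hun hsu' he
    have hu0 : 0 ≤ u := by linarith
    have hs1 := Nat.floor_le hs
    have hs2 := Nat.lt_floor_add_one s
    have hu1 := Nat.floor_le hu0
    have hu2 := Nat.lt_floor_add_one u
    have hlt : ⌊s⌋₊ + 1 ≤ ⌊u⌋₊ := by
      rw [← Nat.floor_add_one hs]
      exact Nat.floor_le_floor hsu
    obtain ⟨m, hm⟩ := Nat.exists_eq_add_of_le ((Nat.le_succ _).trans hlt)
    have hmem : ∀ v : ℝ, 0 ≤ v → v - ⌊v⌋₊ ∈ Ico (0 : ℝ) 1 := fun v hv =>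
      ⟨sub_nonneg.2 (Nat.floor_le hv), by linarith [Nat.lt_floor_add_one v]⟩
    simp only [hc] at he
    nth_rw 1 [hm] at he
    rw [Function.iterate_add_apply] at he
    have he' := f.injective.iterate _ he
    rcases lt_or_ge m n with hmn | hmn
    · exact harc m (by omega) hmn _ (hmem s hs) _ (hmem u hu0) he'.symm
    · have hun' : ⌊u⌋₊ ≤ n := by
        have := Nat.floor_le_floor hun
        rwa [Nat.floor_natCast] at this
      have hfu : ⌊u⌋₊ = n := by omega
      have hfs : ⌊s⌋₊ = 0 := by omega
      have hmn' : m = n := by omega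
      rw [hfu] at hu1
      have hu : u = n := le_antisymm hun hu1
      rw [hfs, hmn', hfu, hu] at he'
      simp only [Nat.cast_zero, sub_zero, sub_self, hα0, hp] at he'
      rw [hfs] at hs2
      refine hαp s ⟨?_, by simpa using hs2⟩ he'
      rcases hsu' with h | h
      · exact h
      · exact absurd hu h.ne

/-- A free open connected set is disjoint from all its iterates. -/
theorem iterate_notMem_of_free {f : ℂ ≃ₜ ℂ} (hf : HasChordLog f) (hfix : ∀ x, f x ≠ x)
    {V : Set ℂ} (hV : IsOpen V) (hVc : IsPreconnected V) (hfree : ∀ x ∈ V, f x ∉ V) {m : ℕ}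
    (hm : 1 ≤ m) : ∀ x ∈ V, f^[m] x ∉ V :=
  iterate_notMem_of_noPeriodicPoint hf hfix hV hVc hfree m hm fun k hk _ => noPeriodicPoint k hk

theorem HasChordLog.of_isotopicToId {g : Plane ≃ₜ Plane} (hg : IsotopicToId g) :
    HasChordLog ((Complex.equivRealProdCLM.toHomeomorph.trans g).trans
      Complex.equivRealProdCLM.symm.toHomeomorph) := by
  obtain ⟨H, hH, h0, h1⟩ := hg
  have key := HasChordLog.of_isotopy
    (fun t => (Complex.equivRealProdCLM.toHomeomorph.trans (H t)).trans
      Complex.equivRealProdCLM.symm.toHomeomorph) ?_ ?_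
  · simpa only [h1] using key
  · exact Complex.equivRealProdCLM.symm.continuous.comp
      (hH.comp (continuous_fst.prodMk (Complex.equivRealProdCLM.continuous.comp continuous_snd)))
  · ext x
    simp only [h0]
    exact Complex.equivRealProdCLM.symm_apply_apply x

/-- A free connected open set of a fixed-point-free homeomorphism isotopic to the identity is
disjoint from all its iterates. -/
theorem IsotopicToId.zpow_notMem_of_free {g : Plane ≃ₜ Plane} (hg : IsotopicToId g)
    (hfix : ∀ x, g x ≠ x) {V : Set Plane} (hV : IsOpen V) (hVc : IsPreconnected V)
    (hfree : ∀ x ∈ V, g x ∉ V) {k : ℤ} (hk : k ≠ 0) : ∀ x ∈ V, (g ^ k) x ∉ V := by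
  set e : Plane ≃ₜ ℂ := Complex.equivRealProdCLM.symm.toHomeomorph with he
  set f : ℂ ≃ₜ ℂ := (Complex.equivRealProdCLM.toHomeomorph.trans g).trans e with hf
  have hfe : ∀ x, f (e x) = e (g x) := fun x => rfl
  have hfree' : ∀ z ∈ e '' V, f z ∉ e '' V := by
    rintro _ ⟨x, hx, rfl⟩ ⟨y, hy, hxy⟩
    rw [hfe] at hxy
    exact hfree x hx (e.injective hxy ▸ hy)
  have hiter : ∀ (m : ℕ) (x : Plane), f^[m] (e x) = e ((g ^ m) x) := by
    intro m
    induction m with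
    | zero => intro x; rfl
    | succ m ih =>
      intro x
      rw [Function.iterate_succ_apply, hfe, ih, pow_succ]
      rfl
  have hnat : ∀ m : ℕ, 1 ≤ m → ∀ x ∈ V, (g ^ m) x ∉ V := by
    intro m hm x hx hmx
    refine iterate_notMem_of_free (f := f) (HasChordLog.of_isotopicToId hg) (fun z hz => ?_)
      (e.isOpenMap V hV) (hVc.image e e.continuous.continuousOn) hfree' hm (e x) ⟨x, hx, rfl⟩ ?_
    · obtain ⟨y, rfl⟩ := e.surjective z
      exact hfix y (e.injective ((hfe y).symm.trans hz))
    · rw [hiter]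
      exact ⟨_, hmx, rfl⟩
  intro x hx hkx
  obtain ⟨m, rfl | rfl⟩ := k.eq_nat_or_neg
  · rw [zpow_natCast] at hkx
    exact hnat m (by omega) x hx hkx
  · refine hnat m (by omega) _ hkx ?_
    rw [← zpow_natCast, ← Homeomorph.mul_apply, ← zpow_add]
    simpa using hx

theorem BrouwerHomeo.iter_eq_zpow (h : BrouwerHomeo) (k : ℤ) :
    h.iter k = ⇑(h.toHomeomorph ^ k) := by
  let φ : (Plane ≃ₜ Plane) →* Equiv.Perm Plane :=
    { toFun := Homeomorph.toEquiv, map_one' := rfl, map_mul' := fun _ _ => rfl }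
  exact congrArg DFunLike.coe (map_zpow φ h.toHomeomorph k).symm

/-- An open set which is disjoint from all its iterates misses the Hausdorff limit of a sequence
of iterates of one of its subsets. -/
theorem HausdorffConvergesTo.disjoint_zpow_image {g : Plane ≃ₜ Plane} {D V : Set Plane}
    {ν : ℕ → ℤ} {L : Set (OnePoint Plane)} (hν : ∀ k, ∀ᶠ n in atTop, ν n ≠ k)
    (hV : IsOpen V) (hDV : D ⊆ V) (hw : ∀ k : ℤ, k ≠ 0 → ∀ x ∈ V, (g ^ k) x ∉ V)
    (hL : HausdorffConvergesTo (fun n => OnePoint.some '' (⇑(g ^ ν n) '' D)) L)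
    (k : ℤ) {x : Plane} (hx : x ∈ V) : OnePoint.some ((g ^ k) x) ∉ L := by
  intro hxL
  have hO : IsOpen (OnePoint.some '' (⇑(g ^ k) '' V)) :=
    OnePoint.isOpen_image_coe.2 ((g ^ k).isOpenMap V hV)
  obtain ⟨n, hn, hnk⟩ := ((hL.2 _ hO ⟨_, hxL, _, ⟨x, hx, rfl⟩, rfl⟩).and (hν k)).exists
  obtain ⟨_, ⟨_, ⟨a, ha, rfl⟩, rfl⟩, _, ⟨b, hb, rfl⟩, hab⟩ := hn
  have hab' : (g ^ k) b = (g ^ ν n) a := OnePoint.coe_injective hab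
  refine hw (ν n - k) (sub_ne_zero.2 hnk) a (hDV ha) ?_
  rw [show ν n - k = -k + ν n by ring, zpow_add, Homeomorph.mul_apply, ← hab',
    ← Homeomorph.mul_apply, ← zpow_add]
  simpa using hb

/-- A point of the plane belongs to the Hausdorff limit of the iterates of a set if and only if
each of its neighbourhoods meets infinitely many of these iterates. -/
theorem HausdorffConvergesTo.coe_mem_iff {g : Plane ≃ₜ Plane} {D V : Set Plane}
    {ν : ℕ → ℤ} {L : Set (OnePoint Plane)} (hν : ∀ k, ∀ᶠ n in atTop, ν n ≠ k)
    (hV : IsOpen V) (hDV : D ⊆ V) (hw : ∀ k : ℤ, k ≠ 0 → ∀ x ∈ V, (g ^ k) x ∉ V)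
    (hL : HausdorffConvergesTo (fun n => OnePoint.some '' (⇑(g ^ ν n) '' D)) L) (y : Plane) :
    OnePoint.some y ∈ L ↔
      ∀ W : Set Plane, IsOpen W → y ∈ W → ∃ᶠ n in atTop, (⇑(g ^ ν n) '' D ∩ W).Nonempty := by
  constructor
  · intro hy W hW hyW
    refine (hL.2 _ (OnePoint.isOpen_image_coe.2 hW) ⟨_, hy, y, hyW, rfl⟩).frequently.mono ?_
    rintro n ⟨_, ⟨a, ha, rfl⟩, b, hb, hab⟩
    exact ⟨a, ha, OnePoint.coe_injective hab ▸ hb⟩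
  · intro hy
    by_contra hyL
    obtain ⟨φ, hφ, hφ'⟩ := Filter.extraction_forall_of_frequently fun j : ℕ =>
      hy (Metric.ball y (1 / ((j : ℝ) + 1))) Metric.isOpen_ball
        (Metric.mem_ball_self Nat.one_div_pos_of_nat)
    choose p hp hpy using hφ'
    have hlim : Tendsto p atTop (𝓝 y) := by
      rw [tendsto_iff_dist_tendsto_zero]
      exact squeeze_zero (fun _ => dist_nonneg) (fun j => (hpy j).le)
        tendsto_one_div_add_atTop_nhds_zero_nat
    have hK := hlim.isCompact_insert_range
    have hU : IsOpen ((OnePoint.some '' insert y (range p))ᶜ : Set (OnePoint Plane)) :=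
      OnePoint.isOpen_compl_image_coe.2 ⟨hK.isClosed, hK⟩
    have hLU : L ⊆ (OnePoint.some '' insert y (range p))ᶜ := by
      rintro _ hz ⟨z, rfl | ⟨j, rfl⟩, rfl⟩
      · exact hyL hz
      · obtain ⟨a, ha, haj⟩ := hp j
        exact hL.disjoint_zpow_image hν hV hDV hw (ν (φ j)) (hDV ha) (haj ▸ hz)
    obtain ⟨j, hj⟩ := (hφ.tendsto_atTop.eventually (hL.1 _ hU hLU)).exists
    exact hj ⟨p j, hp j, rfl⟩ ⟨p j, Or.inr ⟨j, rfl⟩, rfl⟩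

/-- The limit of the iterates of a set is closed in the plane. -/
theorem HausdorffConvergesTo.isClosed_preimage {g : Plane ≃ₜ Plane} {D V : Set Plane}
    {ν : ℕ → ℤ} {L : Set (OnePoint Plane)} (hν : ∀ k, ∀ᶠ n in atTop, ν n ≠ k)
    (hV : IsOpen V) (hDV : D ⊆ V) (hw : ∀ k : ℤ, k ≠ 0 → ∀ x ∈ V, (g ^ k) x ∉ V)
    (hL : HausdorffConvergesTo (fun n => OnePoint.some '' (⇑(g ^ ν n) '' D)) L) :
    IsClosed {x : Plane | OnePoint.some x ∈ L} := by
  refine isClosed_iff_clusterPt.2 fun y hy => ?_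
  refine (hL.coe_mem_iff hν hV hDV hw y).2 fun W hW hyW => ?_
  obtain ⟨z, hzW, hz⟩ := mem_closure_iff.1 (mem_closure_iff_clusterPt.2 hy) W hW hyW
  exact (hL.coe_mem_iff hν hV hDV hw z).1 hz W hW hzW

/-- The limit of the iterates of a set along a sequence which eventually absorbs its
translate by `i` is mapped into itself by the `i`-th iterate. -/
theorem HausdorffConvergesTo.zpow_apply_mem {g : Plane ≃ₜ Plane} {D V : Set Plane}
    {ν : ℕ → ℤ} {L : Set (OnePoint Plane)} (hν : ∀ k, ∀ᶠ n in atTop, ν n ≠ k)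
    (hV : IsOpen V) (hDV : D ⊆ V) (hw : ∀ k : ℤ, k ≠ 0 → ∀ x ∈ V, (g ^ k) x ∉ V)
    (hL : HausdorffConvergesTo (fun n => OnePoint.some '' (⇑(g ^ ν n) '' D)) L)
    {i : ℤ} {σ : ℕ → ℕ} (hσ : Tendsto σ atTop atTop) (hi : ∀ᶠ n in atTop, i + ν n = ν (σ n))
    {y : Plane} (hy : OnePoint.some y ∈ L) : OnePoint.some ((g ^ i) y) ∈ L := by
  refine (hL.coe_mem_iff hν hV hDV hw _).2 fun W hW hyW => hσ.frequently ?_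
  have h1 := (hL.coe_mem_iff hν hV hDV hw _).1 hy _ (hW.preimage (g ^ i).continuous) hyW
  refine (h1.and_eventually hi).mono ?_
  rintro n ⟨⟨_, ⟨a, ha, rfl⟩, haW⟩, hn⟩
  refine ⟨_, ⟨a, ha, rfl⟩, ?_⟩
  rw [← hn, zpow_add]
  exact haW

/-- If an invariant set misses every free continuum containing the free continuum `D`, then
every point of `D` can be connected to its image outside of this set. -/
theorem exists_isPreconnected_mem_apply {g : Plane ≃ₜ Plane} (hfix : ∀ x, g x ≠ x)
    {D S : Set Plane} (hD : IsCompact D) (hDc : IsPreconnected D)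
    (hDfree : Disjoint (g '' D) D) (hinv : ∀ x, g x ∈ S ↔ x ∈ S)
    (hS : ∀ X, IsCompact X → IsPreconnected X → D ⊆ X → Disjoint (g '' X) X → Disjoint X S)
    {x : Plane} (hx : x ∈ D) :
    ∃ C, IsPreconnected C ∧ C ⊆ Sᶜ ∧ x ∈ C ∧ g x ∈ C := by
  set γ : ℝ → Plane := fun t => AffineMap.lineMap x (g x) t with hγdef
  have hγ : Continuous γ := AffineMap.lineMap_continuous
  have hγ0 : γ 0 = x := AffineMap.lineMap_apply_zero _ _
  have hγ1 : γ 1 = g x := AffineMap.lineMap_apply_one _ _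
  set X : ℝ → Set Plane := fun t => D ∪ γ '' Icc 0 t with hXdef
  have hXmono : ∀ {s t : ℝ}, s ≤ t → X s ⊆ X t := fun hst =>
    union_subset_union_right _ (image_mono (Icc_subset_Icc_right hst))
  have hXcpt : ∀ t, IsCompact (X t) := fun t => hD.union (isCompact_Icc.image hγ)
  have hXc : ∀ t, 0 ≤ t → IsPreconnected (X t) := fun t ht =>
    hDc.union x hx ⟨0, ⟨le_rfl, ht⟩, hγ0⟩ (isPreconnected_Icc.image _ hγ.continuousOn)
  have hX0 : X 0 = D := by
    simp only [hXdef, Icc_self, image_singleton, hγ0]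
    exact union_eq_left.2 (singleton_subset_iff.2 hx)
  set B : Set ℝ := {t | t ∈ Icc (0 : ℝ) 1 ∧ ¬ Disjoint (g '' X t) (X t)} with hBdef
  have h1B : (1 : ℝ) ∈ B := by
    refine ⟨⟨zero_le_one, le_rfl⟩, not_disjoint_iff.2 ⟨g x, ⟨x, Or.inl hx, rfl⟩, Or.inr ?_⟩⟩
    exact ⟨1, ⟨zero_le_one, le_rfl⟩, hγ1⟩
  have hBbdd : BddBelow B := ⟨0, fun t ht => ht.1.1⟩
  set T := sInf B with hT
  have hT0 : 0 ≤ T := le_csInf ⟨1, h1B⟩ fun t ht => ht.1.1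
  have hT1 : T ≤ 1 := csInf_le hBbdd h1B
  have hlt : ∀ t, 0 ≤ t → t < T → Disjoint (g '' X t) (X t) := fun t ht htT => by
    by_contra hcon
    exact (csInf_le hBbdd ⟨⟨ht, htT.le.trans hT1⟩, hcon⟩).not_gt htT
  have hXT : ¬ Disjoint (g '' X T) (X T) := by
    intro hdis
    obtain ⟨V, hV, -, hXV, hVfree⟩ := exists_open_free g (hXcpt T) (hXc T hT0) hdis
    have hnhds : γ ⁻¹' V ∈ 𝓝 T := hγ.continuousAt.preimage_mem_nhds
      (hV.mem_nhds (hXV (Or.inr ⟨T, ⟨hT0, le_rfl⟩, rfl⟩)))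
    obtain ⟨δ, hδ, hball⟩ := Metric.mem_nhds_iff.1 hnhds
    obtain ⟨t, htB, htT⟩ := exists_lt_of_csInf_lt ⟨1, h1B⟩ (show sInf B < T + δ by linarith)
    refine htB.2 (disjoint_left.2 ?_)
    have hsub : X t ⊆ V := by
      rintro _ (hz | ⟨s, hs, rfl⟩)
      · exact hXV (Or.inl hz)
      · rcases le_total s T with h | h
        · exact hXV (Or.inr ⟨s, ⟨hs.1, h⟩, rfl⟩)
        · refine hball (?_ : s ∈ Metric.ball T δ)
          rw [Metric.mem_ball, Real.dist_eq, abs_of_nonneg (by linarith)]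
          linarith [hs.2]
    rintro _ ⟨z, hz, rfl⟩ hz'
    exact hVfree z (hsub hz) (hsub hz')
  have hTpos : 0 < T := by
    refine hT0.lt_of_ne fun h => hXT ?_
    rw [← h, hX0]
    exact hDfree
  have hsplit : ∀ z ∈ X T, z = γ T ∨ ∃ t, 0 ≤ t ∧ t < T ∧ z ∈ X t := by
    rintro z (hz | ⟨s, hs, rfl⟩)
    · exact Or.inr ⟨0, le_rfl, hTpos, Or.inl hz⟩
    · rcases hs.2.eq_or_lt with h | h
      · exact Or.inl (by rw [h])
      · exact Or.inr ⟨s, hs.1, h, Or.inr ⟨s, ⟨hs.1, le_rfl⟩, rfl⟩⟩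
  have hnot : ∀ t, 0 ≤ t → t < T → ∀ z ∈ X t, z ∉ S := fun t ht htT z hz =>
    disjoint_left.1 (hS _ (hXcpt t) (hXc t ht) subset_union_left (hlt t ht htT)) hz
  obtain ⟨_, ⟨a, ha, rfl⟩, hb⟩ := not_disjoint_iff.1 hXT
  have hγT : γ T ∉ S := by
    rcases hsplit a ha with ha' | ⟨s, hs, hsT, has⟩
    · rcases hsplit _ hb with hb' | ⟨t, ht, htT, hbt⟩
      · exact absurd (hb'.trans ha'.symm) (hfix a)
      · rw [← ha', ← hinv]
        exact hnot t ht htT _ hbt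
    · rcases hsplit _ hb with hb' | ⟨t, ht, htT, hbt⟩
      · rw [← hb', hinv]
        exact hnot s hs hsT _ has
      · exact absurd (hXmono (le_max_right s t) hbt) (disjoint_left.1
          (hlt (max s t) (hs.trans (le_max_left _ _)) (max_lt hsT htT))
          ⟨a, hXmono (le_max_left s t) has, rfl⟩)
  have hXS : ∀ z ∈ X T, z ∉ S := by
    intro z hz
    rcases hsplit z hz with rfl | ⟨t, ht, htT, hzt⟩
    · exact hγT
    · exact hnot t ht htT z hzt
  refine ⟨X T ∪ g '' X T, ?_, ?_, Or.inl (Or.inl hx), Or.inr ⟨x, Or.inl hx, rfl⟩⟩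
  · exact (hXc T hT0).union (g a) hb ⟨a, ha, rfl⟩
      ((hXc T hT0).image _ g.continuous.continuousOn)
  · rintro _ (hz | ⟨z, hz, rfl⟩)
    · exact hXS _ hz
    · exact fun h => hXS z hz ((hinv z).1 h)

/-- A component of the complement of a closed set `S` whose closure contains `S` has
frontier `S`. -/
theorem frontier_connectedComponentIn_compl {X : Type*} [TopologicalSpace X]
    [LocallyConnectedSpace X] {S : Set X} (hS : IsClosed S) (x : X)
    (h : S ⊆ closure (connectedComponentIn Sᶜ x)) :
    frontier (connectedComponentIn Sᶜ x) = S := by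
  rw [(hS.isOpen_compl.connectedComponentIn).frontier_eq]
  refine Subset.antisymm ?_ fun y hy => ⟨h hy, fun hyU => connectedComponentIn_subset _ _ hyU hy⟩
  rintro y ⟨hy, hyU⟩
  by_contra hyS
  obtain ⟨z, hz, hzx⟩ := mem_closure_iff.1 hy _ (hS.isOpen_compl.connectedComponentIn (x := y))
    (mem_connectedComponentIn hyS)
  exact hyU (connectedComponentIn_eq hzx ▸ connectedComponentIn_eq hz ▸
    mem_connectedComponentIn hyS)

theorem IsClosedDisk.isCompact {D : Set Plane} (hD : IsClosedDisk D) : IsCompact D := by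
  obtain ⟨e⟩ := hD
  have : CompactSpace (Metric.closedBall (0 : Plane) 1) :=
    isCompact_iff_compactSpace.1 (isCompact_closedBall _ _)
  exact isCompact_iff_compactSpace.2 e.symm.compactSpace

theorem IsClosedDisk.isPreconnected {D : Set Plane} (hD : IsClosedDisk D) :
    IsPreconnected D := by
  obtain ⟨e⟩ := hD
  have : PreconnectedSpace (Metric.closedBall (0 : Plane) 1) :=
    isPreconnected_iff_preconnectedSpace.1 (convex_closedBall _ _).isPreconnected
  have key := isPreconnected_range (continuous_subtype_val.comp e.symm.continuous)
  rwa [EquivLike.range_comp, Subtype.range_coe] at key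

/-- With `lim⁺D`, `lim⁻D` the limit sets of a free closed topological
disk `D`, the connected component `U(D)` of `ℝ² \ (lim⁺D ∪ lim⁻D)` containing `D` is
invariant under `h`, and its frontier is exactly `lim⁺D ∪ lim⁻D`. -/
theorem component_of_disk_invariant_frontier (h : BrouwerHomeo) (D : Set Plane)
    (hD : IsClosedDisk D) (hfree : IsFree h D)
    (Lp Lm : Set (OnePoint Plane))
    (hLp : HausdorffConvergesTo (fun n : ℕ => OnePoint.some '' (h.iter (n : ℤ) '' D)) Lp)
    (hLm : HausdorffConvergesTo (fun n : ℕ => OnePoint.some '' (h.iter (-(n : ℤ)) '' D)) Lm)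
    (x₀ : Plane) (hx₀ : x₀ ∈ D) :
    ∀ U : Set Plane,
      U = connectedComponentIn
            (({x : Plane | OnePoint.some x ∈ Lp} ∪ {x : Plane | OnePoint.some x ∈ Lm})ᶜ) x₀ →
      h.toHomeomorph '' U = U ∧
      frontier U = {x : Plane | OnePoint.some x ∈ Lp} ∪ {x : Plane | OnePoint.some x ∈ Lm} := by
  rintro U rfl
  set g := h.toHomeomorph with hg
  simp only [h.iter_eq_zpow] at hLp hLm
  have hfreeV := fun V => h.orientationPreserving.zpow_notMem_of_free h.fixedPointFree (V := V)
  obtain ⟨V, hV, hVc, hDV, hVfree⟩ := exists_open_free g hD.isCompact hD.isPreconnected hfree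
  have hw : ∀ k : ℤ, k ≠ 0 → ∀ x ∈ V, (g ^ k) x ∉ V := fun k hk => hfreeV V hV hVc hVfree hk
  have hνp : ∀ k : ℤ, ∀ᶠ n : ℕ in atTop, (n : ℤ) ≠ k := fun k =>
    (eventually_gt_atTop k.natAbs).mono fun n hn => by omega
  have hνm : ∀ k : ℤ, ∀ᶠ n : ℕ in atTop, -(n : ℤ) ≠ k := fun k =>
    (eventually_gt_atTop k.natAbs).mono fun n hn => by omega
  set S : Set Plane := {x | OnePoint.some x ∈ Lp} ∪ {x | OnePoint.some x ∈ Lm} with hS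
  have hSclosed : IsClosed S := (hLp.isClosed_preimage hνp hV hDV hw).union
    (hLm.isClosed_preimage hνm hV hDV hw)
  have hsucc : Tendsto (fun n : ℕ => n + 1) atTop atTop := tendsto_add_atTop_nat 1
  have hpred : Tendsto (fun n : ℕ => n - 1) atTop atTop := tendsto_sub_atTop_nat 1
  have hfwd : ∀ x ∈ S, (g ^ (1 : ℤ)) x ∈ S := by
    rintro x (hx | hx)
    · exact Or.inl (hLp.zpow_apply_mem hνp hV hDV hw hsucc
        (.of_forall fun n => by push_cast; ring) hx)
    · exact Or.inr (hLm.zpow_apply_mem hνm hV hDV hw hpred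
        ((eventually_ge_atTop 1).mono fun n hn => by omega) hx)
  have hbwd : ∀ x ∈ S, (g ^ (-1 : ℤ)) x ∈ S := by
    rintro x (hx | hx)
    · exact Or.inl (hLp.zpow_apply_mem hνp hV hDV hw hpred
        ((eventually_ge_atTop 1).mono fun n hn => by omega) hx)
    · exact Or.inr (hLm.zpow_apply_mem hνm hV hDV hw hsucc
        (.of_forall fun n => by push_cast; ring) hx)
  have hinv : ∀ x, g x ∈ S ↔ x ∈ S := by
    refine fun x => ⟨fun hx => ?_, fun hx => ?_⟩
    · have := hbwd _ hx
      rwa [zpow_neg_one, ← Homeomorph.mul_apply, inv_mul_cancel] at this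
    · simpa using hfwd x hx
  have hfreeS : ∀ X, IsCompact X → IsPreconnected X → D ⊆ X → Disjoint (g '' X) X →
      Disjoint X S := by
    intro X hX hXc hDX hXfree
    obtain ⟨O, hO, hOc, hXO, hOfree⟩ := exists_open_free g hX hXc hXfree
    have hwO := fun k (hk : k ≠ 0) => hfreeV O hO hOc hOfree hk
    refine disjoint_left.2 fun x hx hxS => ?_
    rcases hxS with hxS | hxS
    · exact hLp.disjoint_zpow_image hνp hO (hDX.trans hXO) hwO 0 (hXO hx) (by simpa using hxS)
    · exact hLm.disjoint_zpow_image hνm hO (hDX.trans hXO) hwO 0 (hXO hx) (by simpa using hxS)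
  have hDS : D ⊆ Sᶜ := disjoint_left.1
    (hfreeS D hD.isCompact hD.isPreconnected Subset.rfl hfree)
  obtain ⟨C, hC, hCS, hxC, hgxC⟩ := exists_isPreconnected_mem_apply h.fixedPointFree
    hD.isCompact hD.isPreconnected hfree hinv hfreeS hx₀
  have hSimage : g '' Sᶜ = Sᶜ := by
    ext y
    obtain ⟨x, rfl⟩ := g.surjective y
    rw [g.injective.mem_set_image, mem_compl_iff, mem_compl_iff, hinv]
  have hU : g '' connectedComponentIn Sᶜ x₀ = connectedComponentIn Sᶜ x₀ := by
    rw [g.image_connectedComponentIn (hDS hx₀), hSimage]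
    exact (connectedComponentIn_eq (hC.subset_connectedComponentIn hxC hCS hgxC)).symm
  refine ⟨hU, frontier_connectedComponentIn_compl hSclosed x₀ fun y hy => ?_⟩
  have hmem : ∀ z, g z ∈ connectedComponentIn Sᶜ x₀ ↔ z ∈ connectedComponentIn Sᶜ x₀ := fun z => by
    conv_lhs => rw [← hU]
    exact g.injective.mem_set_image
  have hDU : ∀ k : ℤ, ∀ a ∈ D, (g ^ k) a ∈ connectedComponentIn Sᶜ x₀ := by
    intro k a ha
    induction k using Int.induction_on with
    | zero => exact hD.isPreconnected.subset_connectedComponentIn hx₀ hDS ha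
    | succ i ih =>
      rw [add_comm, zpow_add, zpow_one, Homeomorph.mul_apply, hmem]
      exact ih
    | pred i ih =>
      rwa [← hmem, ← Homeomorph.mul_apply, ← zpow_one_add, add_sub_cancel]
  refine mem_closure_iff.2 fun W hW hyW => ?_
  rcases hy with hy | hy
  · obtain ⟨n, _, ⟨a, ha, rfl⟩, haW⟩ :=
      ((hLp.coe_mem_iff hνp hV hDV hw y).1 hy W hW hyW).exists
    exact ⟨_, haW, hDU _ a ha⟩
  · obtain ⟨n, _, ⟨a, ha, rfl⟩, haW⟩ :=
      ((hLm.coe_mem_iff hνm hV hDV hw y).1 hy W hW hyW).exists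
    exact ⟨_, haW, hDU _ a ha⟩
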